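/- Let Γ be a distance-regular graph with classical parameters (D, b, α, β) such that b ≥ 2 and D ≥ 3, let r = [D], and let s be a positive integer such that Γ has the SPLS(s) property. Assume β satisfies: (1) β > (b+2)(b+1)(s−1) − (b(b+1) + r − 1)α; (2) β > ((b+1)(b²+b+1) − 2)(s−b) − α(b+1)r + α(b+1)²; (3) β > ((b+1)(b²+b+1) − 2 + b)(s−b) − α(r−1) + b² − b. Then Γ is geometric. -/

import Mathlib

open SimpleGraph

namespace DRGPaper

variable {V : Type*}

/-- `Γ` is a distance-regular graph with diameter `D` and intersection arrays `cc`, `aa`, `bb`: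
`Γ` is connected of diameter `D` and for any vertices `x, y` at distance `i ≤ D`, `y` has exactly
`cc i` neighbours at distance `i - 1` from `x`, `aa i` neighbours at distance `i` from `x`,
and `bb i` neighbours at distance `i + 1` from `x`. -/
def IsDRG [Fintype V] (G : SimpleGraph V) (D : ℕ) (cc aa bb : ℕ → ℕ) : Prop :=
  G.Connected ∧
  (∀ x y : V, G.dist x y ≤ D) ∧
  (∃ x y : V, G.dist x y = D) ∧
  ∀ i : ℕ, i ≤ D → ∀ x y : V, G.dist x y = i →
    {z : V | G.Adj y z ∧ G.dist x z = i - 1}.ncard = cc i ∧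
    {z : V | G.Adj y z ∧ G.dist x z = i}.ncard = aa i ∧
    {z : V | G.Adj y z ∧ G.dist x z = i + 1}.ncard = bb i

/-- `[j] = (b^j - 1)/(b - 1) = 1 + b + ⋯ + b^(j-1)` as a real number. -/
def gauss (b j : ℕ) : ℝ := ∑ i ∈ Finset.range j, (b : ℝ) ^ i

/-- `Γ` has classical parameters `(D, b, α, β)`: it is distance-regular of diameter `D` with
`bb i = ([D] - [i])(β - α[i])` for `0 ≤ i ≤ D - 1` and `cc i = [i](1 + α[i-1])` for
`1 ≤ i ≤ D`. -/
def HasClassicalParams [Fintype V] (G : SimpleGraph V) (D b : ℕ) (α β : ℝ)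
    (cc aa bb : ℕ → ℕ) : Prop :=
  IsDRG G D cc aa bb ∧
  (∀ i : ℕ, i ≤ D - 1 → (bb i : ℝ) = (gauss b D - gauss b i) * (β - α * gauss b i)) ∧
  (∀ i : ℕ, 1 ≤ i → i ≤ D → (cc i : ℝ) = gauss b i * (1 + α * gauss b (i - 1)))

/-- `d(x, C) = min {d(x, y) : y ∈ C}`. -/
noncomputable def distToSet (G : SimpleGraph V) (x : V) (C : Set V) : ℕ :=
  sInf (G.dist x '' C)

/-- A maximal clique of `G`. -/
def IsMaxClique (G : SimpleGraph V) (s : Set V) : Prop :=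
  G.IsClique s ∧ ∀ t : Set V, G.IsClique t → s ⊆ t → t = s

/-- The lines for the PLS(γ) property: maximal cliques with at least `γ` vertices. -/
def plsLines (G : SimpleGraph V) (γ : ℕ) : Set (Set V) :=
  {ℓ : Set V | IsMaxClique G ℓ ∧ γ ≤ ℓ.ncard}

/-- `G` is the point graph of the partial linear space with line set `L`: any two adjacent
vertices lie on exactly one common line of `L`. -/
def IsPointGraphOf (G : SimpleGraph V) (L : Set (Set V)) : Prop :=
  ∀ x y : V, G.Adj x y → ∃! ℓ : Set V, ℓ ∈ L ∧ x ∈ ℓ ∧ y ∈ ℓ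

/-- A vertex is a Delsarte vertex (w.r.t. the line set `L` and classical parameter `β`) if all
lines through it have exactly `β + 1` vertices. -/
def IsDelsarteVertex (L : Set (Set V)) (β : ℝ) (x : V) : Prop :=
  ∀ ℓ ∈ L, x ∈ ℓ → (ℓ.ncard : ℝ) = β + 1

/-- The lines for the SPLS(c, s) property: maximal cliques with at least
`a1 + 2 - (c - 1)(s - 1)` vertices. -/
def splsLines (G : SimpleGraph V) (a1 c s : ℕ) : Set (Set V) :=
  {ℓ : Set V | IsMaxClique G ℓ ∧ (a1 : ℤ) + 2 - ((c : ℤ) - 1) * ((s : ℤ) - 1) ≤ (ℓ.ncard : ℤ)}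

/-- The SPLS(c, s) property: `G` is the point graph of the partial linear space whose lines are
the maximal cliques with at least `a1 + 2 - (c-1)(s-1)` vertices, `a1 ≥ (2s-1)(c-1)`, each
vertex lies on at most `s` lines, and every point not on a line `ℓ` is collinear with at most
`c` points of `ℓ`.  SPLS(s) is the case `c = c₂`. -/
def HasSPLS (G : SimpleGraph V) (a1 c s : ℕ) : Prop :=
  1 ≤ c ∧ 2 ≤ s ∧
  (2 * (s : ℤ) - 1) * ((c : ℤ) - 1) ≤ (a1 : ℤ) ∧
  IsPointGraphOf G (splsLines G a1 c s) ∧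
  (∀ x : V, {ℓ ∈ splsLines G a1 c s | x ∈ ℓ}.ncard ≤ s) ∧
  (∀ ℓ ∈ splsLines G a1 c s, ∀ x : V, x ∉ ℓ → {y ∈ ℓ | G.Adj x y}.ncard ≤ c)

/-- `[x, y]`: the set of lines `ℓ ∈ L` through `x` such that `d(y, u) ≤ 2` for all `u ∈ ℓ`. -/
def lineXY (G : SimpleGraph V) (L : Set (Set V)) (x y : V) : Set (Set V) :=
  {ℓ ∈ L | x ∈ ℓ ∧ ∀ u ∈ ℓ, G.dist y u ≤ 2}

/-- `𝓒` witnesses that `G` is geometric with cliques of order `q`: every member of `𝓒` is a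
clique with exactly `q` vertices and every edge of `G` lies in a unique member of `𝓒`. -/
def IsGeomLineSet (G : SimpleGraph V) (q : ℝ) (𝓒 : Set (Set V)) : Prop :=
  (∀ C ∈ 𝓒, G.IsClique C ∧ (C.ncard : ℝ) = q) ∧
  ∀ x y : V, G.Adj x y → ∃! C : Set V, C ∈ 𝓒 ∧ x ∈ C ∧ y ∈ C

/-- `G` is geometric: there is a set of Delsarte cliques (cliques of the maximum order `q`)
such that every edge lies in a unique member. -/
def IsGeometric (G : SimpleGraph V) (q : ℝ) : Prop :=
  ∃ 𝓒 : Set (Set V), IsGeomLineSet G q 𝓒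

/-- An assembly: a maximal clique which is not a line. -/
def IsAssembly (G : SimpleGraph V) (𝓒 : Set (Set V)) (M : Set V) : Prop :=
  IsMaxClique G M ∧ M ∉ 𝓒

/-- The dual Pasch axiom: for every pair of adjacent vertices `x, y`, the common neighbours of
`x` and `y` outside the (any) line of `𝓒` through `x` and `y` form a clique. -/
def DualPasch (G : SimpleGraph V) (𝓒 : Set (Set V)) : Prop :=
  ∀ x y : V, G.Adj x y → ∀ ℓ ∈ 𝓒, x ∈ ℓ → y ∈ ℓ →
    G.IsClique {z : V | G.Adj x z ∧ G.Adj y z ∧ z ∉ ℓ}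

/-- The `m × n` grid, i.e. the Cartesian product `K_m □ K_n`. -/
def gridGraph (m n : ℕ) : SimpleGraph (Fin m × Fin n) :=
  (⊤ : SimpleGraph (Fin m)).boxProd (⊤ : SimpleGraph (Fin n))

/-- The `A`-clique extension of a graph `H`: replace every vertex of `H` by a clique of size
`A`, vertices in distinct cliques being adjacent exactly when the underlying vertices of `H`
are adjacent. -/
def cliqueExt {W : Type*} (H : SimpleGraph W) (A : ℕ) : SimpleGraph (W × Fin A) :=
  SimpleGraph.fromRel (fun p q => H.Adj p.1 q.1 ∨ p.1 = q.1)

/-- `θ` is an eigenvalue of the adjacency matrix of `G`. -/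
def IsAdjEigenvalue [Fintype V] (G : SimpleGraph V) [DecidableRel G.Adj] (θ : ℝ) : Prop :=
  ∃ v : V → ℝ, v ≠ 0 ∧ (G.adjMatrix ℝ).mulVec v = θ • v

section DistanceRegular

open scoped Classical
open Finset

variable {G : SimpleGraph V}

lemma exists_adj_dist_eq_of_dist_eq_succ (hG : G.Connected) {x y : V} {i : ℕ}
    (h : G.dist x y = i + 1) : ∃ z, G.Adj y z ∧ G.dist x z = i := by
  obtain ⟨p, hp⟩ := hG.exists_walk_length_eq_dist y x
  cases p with
  | nil => simp at h
  | cons hadj q =>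
    rename_i z
    refine ⟨z, hadj, ?_⟩
    have h1 := SimpleGraph.dist_le q
    have h2 := hG.dist_triangle (u := x) (v := z) (w := y)
    rw [SimpleGraph.dist_eq_one_iff_adj.mpr hadj.symm] at h2
    rw [SimpleGraph.Walk.length_cons, SimpleGraph.dist_comm, h] at hp
    rw [SimpleGraph.dist_comm] at h1
    omega

lemma exists_dist_eq_of_le (hG : G.Connected) {x y : V} {i : ℕ} (h : i ≤ G.dist x y) :
    ∃ z, G.dist x z = i := by
  obtain ⟨n, hn⟩ := Nat.exists_eq_add_of_le h
  induction n generalizing y with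
  | zero => exact ⟨y, by omega⟩
  | succ n ih =>
    obtain ⟨z, -, hz⟩ := exists_adj_dist_eq_of_dist_eq_succ hG (i := i + n) (by omega : _ = _)
    exact ih (by omega) hz

lemma dist_le_succ_of_adj (hG : G.Connected) {x y z : V} (h : G.Adj y z) :
    G.dist x z ≤ G.dist x y + 1 := by
  have := hG.dist_triangle (u := x) (v := y) (w := z)
  rwa [SimpleGraph.dist_eq_one_iff_adj.mpr h] at this

variable [Fintype V] {D : ℕ} {cc aa bb : ℕ → ℕ}

lemma card_filter_eq_ncard (P : V → Prop) [DecidablePred P] : #{z | P z} = {z | P z}.ncard := by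
  rw [← Set.ncard_coe_finset]; simp

namespace IsDRG

lemma card_c (h : IsDRG G D cc aa bb) {x y : V} {i : ℕ} (hi : i ≤ D) (hxy : G.dist x y = i) :
    #{z | G.Adj y z ∧ G.dist x z = i - 1} = cc i := by
  rw [card_filter_eq_ncard, (h.2.2.2 i hi x y hxy).1]

lemma card_a (h : IsDRG G D cc aa bb) {x y : V} {i : ℕ} (hi : i ≤ D) (hxy : G.dist x y = i) :
    #{z | G.Adj y z ∧ G.dist x z = i} = aa i := by
  rw [card_filter_eq_ncard, (h.2.2.2 i hi x y hxy).2.1]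

lemma card_b (h : IsDRG G D cc aa bb) {x y : V} {i : ℕ} (hi : i ≤ D) (hxy : G.dist x y = i) :
    #{z | G.Adj y z ∧ G.dist x z = i + 1} = bb i := by
  rw [card_filter_eq_ncard, (h.2.2.2 i hi x y hxy).2.2]

lemma exists_dist (h : IsDRG G D cc aa bb) {i : ℕ} (hi : i ≤ D) : ∃ x y, G.dist x y = i := by
  obtain ⟨x, y, hxy⟩ := h.2.2.1
  exact ⟨x, exists_dist_eq_of_le h.1 (hi.trans hxy.ge)⟩

lemma c_pos (h : IsDRG G D cc aa bb) {i : ℕ} (hi : i + 1 ≤ D) : 0 < cc (i + 1) := by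
  obtain ⟨x, y, hxy⟩ := h.exists_dist hi
  obtain ⟨z, hz⟩ := exists_adj_dist_eq_of_dist_eq_succ h.1 hxy
  rw [← h.card_c hi hxy, card_pos]
  exact ⟨z, by simpa using hz⟩

lemma b_pos (h : IsDRG G D cc aa bb) {i : ℕ} (hi : i + 1 ≤ D) : 0 < bb i := by
  obtain ⟨x, y, hxy⟩ := h.exists_dist hi
  obtain ⟨z, hyz, hz⟩ := exists_adj_dist_eq_of_dist_eq_succ h.1 hxy
  rw [← h.card_b (by omega) hz, card_pos]
  exact ⟨y, by simpa using ⟨hyz.symm, hxy⟩⟩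

lemma b_last (h : IsDRG G D cc aa bb) : bb D = 0 := by
  obtain ⟨x, y, hxy⟩ := h.2.2.1
  rw [← h.card_b le_rfl hxy, card_eq_zero, filter_eq_empty_iff]
  rintro z - ⟨-, hz⟩
  have := h.2.1 x z
  omega

lemma dist_zero_iff (h : IsDRG G D cc aa bb) {x y : V} : G.dist x y = 0 ↔ x = y :=
  h.1.dist_eq_zero_iff

lemma card_neighbors (h : IsDRG G D cc aa bb) (x : V) : #{z | G.Adj x z} = bb 0 := by
  rw [← h.card_b (Nat.zero_le D) (G.dist_self (v := x))]
  congr 1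
  ext z
  simp [SimpleGraph.dist_eq_one_iff_adj]

lemma c_zero (h : IsDRG G D cc aa bb) : cc 0 = 0 := by
  obtain ⟨x, -⟩ := h.2.2.1
  rw [← h.card_c (Nat.zero_le D) (G.dist_self (v := x)), card_eq_zero, filter_eq_empty_iff]
  rintro z - ⟨hz, hz'⟩
  exact hz.ne (h.dist_zero_iff.mp hz')

lemma a_zero (h : IsDRG G D cc aa bb) : aa 0 = 0 := by
  obtain ⟨x, -⟩ := h.2.2.1
  rw [← h.card_a (Nat.zero_le D) (G.dist_self (v := x)), card_eq_zero, filter_eq_empty_iff]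
  rintro z - ⟨hz, hz'⟩
  exact hz.ne (h.dist_zero_iff.mp hz')

/-- A sum over the neighbours of `y` of a function of the distance to `x`. -/
lemma sum_adj_dist (h : IsDRG G D cc aa bb) {x y : V} {i : ℕ} (hi : i ≤ D)
    (hxy : G.dist x y = i) (u : ℕ → ℝ) :
    ∑ z with G.Adj y z, u (G.dist x z) = cc i * u (i - 1) + aa i * u i + bb i * u (i + 1) := by
  rcases Nat.eq_zero_or_pos i with rfl | hpos
  · rw [h.dist_zero_iff] at hxy
    subst hxy
    rw [h.c_zero, h.a_zero, ← h.card_neighbors x, sum_congr rfl (g := fun _ => u 1)]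
    · simp
    · intro z hz
      rw [SimpleGraph.dist_eq_one_iff_adj.mpr (by simpa using hz)]
  · have key : ∀ z, G.Adj y z → u (G.dist x z) =
        (if G.dist x z = i - 1 then u (i - 1) else 0) + (if G.dist x z = i then u i else 0) +
          (if G.dist x z = i + 1 then u (i + 1) else 0) := by
      intro z hz
      have h1 := dist_le_succ_of_adj h.1 (x := x) hz
      have h2 := dist_le_succ_of_adj h.1 (x := x) hz.symm
      have : G.dist x z = i - 1 ∨ G.dist x z = i ∨ G.dist x z = i + 1 := by omega
      rcases this with h | h | h
      · rw [h, if_pos rfl, if_neg (by omega), if_neg (by omega)]; ring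
      · rw [h, if_neg (by omega), if_pos rfl, if_neg (by omega)]; ring
      · rw [h, if_neg (by omega), if_neg (by omega), if_pos rfl]; ring
    rw [sum_congr rfl (fun z hz => key z (by simpa using hz)), sum_add_distrib, sum_add_distrib]
    simp only [← sum_filter, filter_filter, sum_const, h.card_c hi hxy, h.card_a hi hxy,
      h.card_b hi hxy, nsmul_eq_mul]

lemma sum_params (h : IsDRG G D cc aa bb) {i : ℕ} (hi : i ≤ D) :
    (cc i : ℝ) + aa i + bb i = bb 0 := by
  obtain ⟨x, y, hxy⟩ := h.exists_dist hi
  have := h.sum_adj_dist hi hxy (fun _ => 1)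
  rw [sum_const, h.card_neighbors, nsmul_eq_mul] at this
  linarith

/-- The sum of an eigenvector over the sphere of radius `i` around `x`. -/
noncomputable def _root_.DRGPaper.sphereSum (G : SimpleGraph V) (f : V → ℝ) (x : V) (i : ℕ) : ℝ :=
  ∑ y with G.dist x y = i, f y

lemma sphereSum_zero (h : IsDRG G D cc aa bb) (f : V → ℝ) (x : V) : sphereSum G f x 0 = f x := by
  have : (univ.filter fun y => G.dist x y = 0) = {x} := by
    ext y; simp [h.dist_zero_iff, eq_comm]
  rw [sphereSum, this, sum_singleton]

lemma sphereSum_of_lt (h : IsDRG G D cc aa bb) (f : V → ℝ) (x : V) {i : ℕ} (hi : D < i) :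
    sphereSum G f x i = 0 := by
  rw [sphereSum, filter_eq_empty_iff.mpr, sum_empty]
  intro y _ hy
  have := h.2.1 x y
  omega

/-- The three-term recurrence for sphere sums of an eigenvector. -/
lemma sphereSum_rec (h : IsDRG G D cc aa bb) {f : V → ℝ} {θ : ℝ}
    (hf : ∀ y, ∑ z with G.Adj y z, f z = θ * f y) (x : V) {i : ℕ} (hi : i ≤ D) :
    θ * sphereSum G f x i = cc (i + 1) * sphereSum G f x (i + 1) + aa i * sphereSum G f x i +
      (if i = 0 then 0 else bb (i - 1) * sphereSum G f x (i - 1)) := by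
  have hcount : ∀ z, (#{y | G.Adj z y ∧ G.dist x y = i} : ℝ) =
      (if G.dist x z = i + 1 then (cc (i + 1) : ℝ) else 0) +
      (if G.dist x z = i then (aa i : ℝ) else 0) +
      (if i = 0 then 0 else if G.dist x z = i - 1 then (bb (i - 1) : ℝ) else 0) := by
    intro z
    have hz := h.2.1 x z
    rcases lt_trichotomy (G.dist x z) i with hlt | heq | hgt
    · rw [if_neg (by omega), if_neg (by omega), if_neg (by omega)]
      split_ifs with h1
      · have := h.card_b (i := i - 1) (by omega) h1
        rw [Nat.sub_add_cancel (by omega)] at this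
        rw [this]; ring
      · rw [filter_eq_empty_iff.mpr]
        · simp
        · rintro y - ⟨hy, hy'⟩
          have := dist_le_succ_of_adj h.1 (x := x) hy
          omega
    · rw [if_neg (by omega), if_pos heq, h.card_a hi heq]
      split_ifs <;> first | omega | ring
    · rw [if_neg (by omega : ¬ G.dist x z = i), if_neg (by omega : ¬ G.dist x z = i - 1)]
      split_ifs with h1
      all_goals first
        | (have := h.card_c (i := i + 1) (by omega) h1
           simp only [Nat.add_sub_cancel] at this
           rw [this]; ring)
        | (rw [filter_eq_empty_iff.mpr]
           · simp
           · rintro y - ⟨hy, hy'⟩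
             have := dist_le_succ_of_adj h.1 (x := x) hy.symm
             omega)
  have hsum : θ * sphereSum G f x i = ∑ z, (#{y | G.Adj z y ∧ G.dist x y = i} : ℝ) * f z := by
    rw [sphereSum, mul_sum, sum_congr rfl (fun y _ => (hf y).symm)]
    simp only [sum_filter]
    have hite : ∀ y, (if G.dist x y = i then ∑ z, (if G.Adj y z then f z else 0) else 0) =
        ∑ z, if G.dist x y = i then (if G.Adj y z then f z else 0) else 0 := by
      intro y; split_ifs <;> simp
    rw [sum_congr rfl (fun y _ => hite y), sum_comm]
    refine sum_congr rfl fun z _ => ?_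
    rw [card_filter, Nat.cast_sum, sum_mul]
    refine sum_congr rfl fun y _ => ?_
    by_cases h1 : G.dist x y = i <;> by_cases h2 : G.Adj y z <;> simp [h1, h2, G.adj_comm z y]
  rw [hsum, sum_congr rfl (fun z _ => by rw [hcount z])]
  simp only [add_mul, sum_add_distrib, ite_mul, zero_mul, ← sum_filter, ← mul_sum, sphereSum]
  split_ifs with h0
  · simp
  · simp only [← sum_filter, ← mul_sum]

end IsDRG

end DistanceRegular
section ClassicalParameters

open scoped Classical
open Finset

lemma gauss_zero (b : ℕ) : gauss b 0 = 0 := by simp [gauss]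

lemma gauss_one (b : ℕ) : gauss b 1 = 1 := by simp [gauss]

lemma gauss_two (b : ℕ) : gauss b 2 = b + 1 := by simp [gauss, sum_range_succ]; ring

lemma gauss_three (b : ℕ) : gauss b 3 = (b : ℝ) ^ 2 + b + 1 := by
  simp [gauss, sum_range_succ]; ring

lemma gauss_lt {b i j : ℕ} (hb : 1 ≤ b) (hij : i < j) : gauss b i < gauss b j :=
  sum_lt_sum_of_subset (i := i) (range_mono hij.le) (by simpa using hij) (by simp)
    (by positivity) (fun _ _ _ => by positivity)

lemma gauss_le {b i j : ℕ} (hb : 1 ≤ b) (hij : i ≤ j) : gauss b i ≤ gauss b j := by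
  rcases hij.eq_or_lt with rfl | h
  · rfl
  · exact (gauss_lt hb h).le

variable [Fintype V] {G : SimpleGraph V} {D b : ℕ} {α β : ℝ} {cc aa bb : ℕ → ℕ}

namespace HasClassicalParams

lemma b_eq (h : HasClassicalParams G D b α β cc aa bb) {i : ℕ} (hi : i ≤ D) :
    (bb i : ℝ) = (gauss b D - gauss b i) * (β - α * gauss b i) := by
  rcases hi.eq_or_lt with rfl | hlt
  · simp [h.1.b_last]
  · exact h.2.1 i (by omega)

lemma c_eq (h : HasClassicalParams G D b α β cc aa bb) {i : ℕ} (hi : i + 1 ≤ D) :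
    (cc (i + 1) : ℝ) = gauss b (i + 1) * (1 + α * gauss b i) :=
  h.2.2 (i + 1) (by omega) hi

lemma valency_eq (h : HasClassicalParams G D b α β cc aa bb) : (bb 0 : ℝ) = gauss b D * β := by
  rw [h.b_eq (Nat.zero_le D), gauss_zero]; ring

lemma a_eq (h : HasClassicalParams G D b α β cc aa bb) {i : ℕ} (hi : i ≤ D) :
    (aa i : ℝ) + gauss b D =
      gauss b i * (β - α * gauss b (i - 1)) + (gauss b D - gauss b i) * (1 + α * gauss b i) := by
  have hs := h.1.sum_params hi
  rw [h.b_eq hi, h.valency_eq] at hs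
  cases i with
  | zero => simp [h.1.a_zero, gauss_zero]
  | succ i =>
    rw [h.c_eq hi] at hs
    simp only [Nat.add_sub_cancel]
    linear_combination hs

lemma one_add_pos (h : HasClassicalParams G D b α β cc aa bb) (hb : 1 ≤ b) {i : ℕ}
    (hi : i + 1 ≤ D) : 0 < 1 + α * gauss b i := by
  have h1 : (0 : ℝ) < cc (i + 1) := by exact_mod_cast h.1.c_pos hi
  rw [h.c_eq hi] at h1
  have h2 := gauss_lt hb (Nat.succ_pos i)
  rw [gauss_zero] at h2
  exact (pos_iff_pos_of_mul_pos h1).mp h2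

lemma sub_pos (h : HasClassicalParams G D b α β cc aa bb) (hb : 1 ≤ b) {i : ℕ}
    (hi : i + 1 ≤ D) : 0 < β - α * gauss b i := by
  have h1 : (0 : ℝ) < bb i := by exact_mod_cast h.1.b_pos hi
  rw [h.b_eq (by omega)] at h1
  exact (pos_iff_pos_of_mul_pos h1).mp (_root_.sub_pos.mpr (gauss_lt hb hi))

/-- No eigenvalue of the graph is smaller than `-[D]`. -/
lemma le_gauss_of_eigenvector (h : HasClassicalParams G D b α β cc aa bb) (hb : 1 ≤ b) (hD : 1 ≤ D)
    {t : ℝ} {f : V → ℝ} (hf0 : f ≠ 0) (hf : ∀ y, ∑ z with G.Adj y z, f z = -t * f y) :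
    t ≤ gauss b D := by
  by_contra! hlt
  obtain ⟨x, hx⟩ := Function.ne_iff.mp hf0
  set T : ℕ → ℝ := fun i => (-1) ^ i * (sphereSum G f x i / f x) with hT
  have hrec : ∀ i ≤ D, cc (i + 1) * T (i + 1) =
      (aa i + t) * T i - (if i = 0 then 0 else bb (i - 1) * T (i - 1)) := by
    intro i hi
    have := h.1.sphereSum_rec hf x hi
    rcases Nat.eq_zero_or_pos i with rfl | hpos
    · simp only [if_true, hT, pow_succ, zero_add] at this ⊢
      linear_combination (f x)⁻¹ * this
    · obtain ⟨j, rfl⟩ := Nat.exists_eq_add_of_le' hpos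
      simp only [if_neg (Nat.succ_ne_zero j), hT, Nat.add_sub_cancel, pow_succ] at this ⊢
      linear_combination -(-1) ^ j * (f x)⁻¹ * this
  -- the ratio of consecutive terms dominates the one of the eigenvalue `-[D]`
  have hind : ∀ i, i + 1 ≤ D → 0 < T i ∧
      (gauss b D - gauss b i) * (1 + α * gauss b i) * T i ≤ cc (i + 1) * T (i + 1) := by
    intro i
    induction i with
    | zero =>
      intro hi
      have hT0 : T 0 = 1 := by
        simp only [hT, pow_zero, one_mul, h.1.sphereSum_zero]
        exact div_self hx
      rw [hrec 0 (by omega), hT0, gauss_zero, h.1.a_zero]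
      simp only [if_true, Nat.cast_zero]
      constructor <;> linarith
    | succ i ih =>
      intro hi
      obtain ⟨hpos, hle⟩ := ih (by omega)
      have h1 := _root_.sub_pos.mpr (gauss_lt hb (show i < D by omega))
      have h2 := h.one_add_pos hb (show i + 1 ≤ D by omega)
      have h3 := h.sub_pos hb (show i + 1 ≤ D by omega)
      have hc : (0 : ℝ) < cc (i + 1) := by exact_mod_cast h.1.c_pos (show i + 1 ≤ D by omega)
      have hpos' : 0 < T (i + 1) :=
        (pos_iff_pos_of_mul_pos (lt_of_lt_of_le (by positivity) hle)).mp hc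
      refine ⟨hpos', ?_⟩
      rw [h.c_eq (by omega)] at hle
      have hle' : (gauss b D - gauss b i) * T i ≤ gauss b (i + 1) * T (i + 1) := by
        refine le_of_mul_le_mul_right ?_ h2
        linarith
      have hmul := mul_le_mul_of_nonneg_right hle' h3.le
      rw [hrec (i + 1) (by omega), if_neg (Nat.succ_ne_zero i), Nat.add_sub_cancel,
        h.b_eq (show i ≤ D by omega)]
      have ha := h.a_eq (show i + 1 ≤ D by omega)
      rw [Nat.add_sub_cancel] at ha
      have : (aa (i + 1) + gauss b D) * T (i + 1) ≤ (aa (i + 1) + t) * T (i + 1) := by gcongr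
      rw [ha] at this
      linarith
  obtain ⟨d, rfl⟩ := Nat.exists_eq_add_of_le' hD
  obtain ⟨hpos, hle⟩ := hind d le_rfl
  have h1 := _root_.sub_pos.mpr (gauss_lt hb (show d < d + 1 by omega))
  have h2 := h.one_add_pos hb (show d + 1 ≤ d + 1 by omega)
  have h3 := h.sub_pos hb (show d + 1 ≤ d + 1 by omega)
  have hc : (0 : ℝ) < cc (d + 1) := by exact_mod_cast h.1.c_pos (le_refl (d + 1))
  have hpos' : 0 < T (d + 1) :=
    (pos_iff_pos_of_mul_pos (lt_of_lt_of_le (by positivity) hle)).mp hc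
  rw [h.c_eq le_rfl] at hle
  have hle' : (gauss b (d + 1) - gauss b d) * T d ≤ gauss b (d + 1) * T (d + 1) := by
    refine le_of_mul_le_mul_right ?_ h2
    linarith
  have hmul := mul_le_mul_of_nonneg_right hle' h3.le
  have hlast := hrec (d + 1) le_rfl
  have hzero : T (d + 1 + 1) = 0 := by simp [hT, h.1.sphereSum_of_lt f x (Nat.lt_succ_self (d + 1))]
  rw [hzero, if_neg (Nat.succ_ne_zero d), Nat.add_sub_cancel, h.b_eq (show d ≤ d + 1 by omega)]
    at hlast
  have ha := h.a_eq (le_refl (d + 1))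
  rw [Nat.add_sub_cancel] at ha
  have : (aa (d + 1) + gauss b (d + 1)) * T (d + 1) < (aa (d + 1) + t) * T (d + 1) := by gcongr
  rw [ha] at this
  linarith

/-- The cosine sequence of the eigenvalue `-[D]`. -/
noncomputable def _root_.DRGPaper.cosine (b : ℕ) (α β : ℝ) : ℕ → ℝ
  | 0 => 1
  | i + 1 => -cosine b α β i * (1 + α * gauss b i) / (β - α * gauss b i)

lemma cosine_rec (h : HasClassicalParams G D b α β cc aa bb) (hb : 1 ≤ b) {i : ℕ} (hi : i ≤ D) :
    cc i * cosine b α β (i - 1) + aa i * cosine b α β i + bb i * cosine b α β (i + 1) =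
      -gauss b D * cosine b α β i := by
  have hup : bb i * cosine b α β (i + 1) =
      -(gauss b D - gauss b i) * (1 + α * gauss b i) * cosine b α β i := by
    rw [h.b_eq hi]
    rcases hi.eq_or_lt with rfl | hlt
    · ring
    · have := (h.sub_pos hb hlt).ne'
      rw [cosine, mul_div_assoc', div_eq_iff this]
      ring
  have hdown : cc i * cosine b α β (i - 1) =
      -gauss b i * (β - α * gauss b (i - 1)) * cosine b α β i := by
    cases i with
    | zero => simp [h.1.c_zero, gauss_zero]
    | succ i =>
      have := (h.sub_pos hb hi).ne'
      rw [h.c_eq hi, Nat.add_sub_cancel, cosine]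
      field_simp
  rw [hup, hdown]
  linear_combination cosine b α β i * h.a_eq hi

lemma cosine_eigenvector (h : HasClassicalParams G D b α β cc aa bb) (hb : 1 ≤ b) (x y : V) :
    ∑ z with G.Adj y z, cosine b α β (G.dist x z) =
      -gauss b D * cosine b α β (G.dist x y) := by
  rw [h.1.sum_adj_dist (h.1.2.1 x y) rfl, h.cosine_rec hb (h.1.2.1 x y)]

lemma _root_.DRGPaper.IsDRG.exists_sphereSum_eq (h : IsDRG G D cc aa bb) (θ : ℝ) (i : ℕ) :
    ∃ κ : ℝ, ∀ (f : V → ℝ), (∀ y, ∑ z with G.Adj y z, f z = θ * f y) →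
      ∀ x, sphereSum G f x i = κ * f x := by
  induction i using Nat.twoStepInduction with
  | zero => exact ⟨1, fun f _ x => by rw [h.sphereSum_zero, one_mul]⟩
  | one =>
    refine ⟨θ, fun f hf x => ?_⟩
    rw [← hf x, sphereSum]
    simp only [SimpleGraph.dist_eq_one_iff_adj]
  | more i ih0 ih1 =>
    obtain ⟨κ0, h0⟩ := ih0
    obtain ⟨κ1, h1⟩ := ih1
    by_cases hi : i + 2 ≤ D
    · refine ⟨((θ - aa (i + 1)) * κ1 - bb i * κ0) / cc (i + 2), fun f hf x => ?_⟩
      have hc : (cc (i + 2) : ℝ) ≠ 0 := by exact_mod_cast (h.c_pos hi).ne'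
      have hrec := h.sphereSum_rec hf x (show i + 1 ≤ D by omega)
      rw [if_neg (Nat.succ_ne_zero i), Nat.add_sub_cancel, h0 f hf, h1 f hf] at hrec
      field_simp
      linear_combination -hrec
    · exact ⟨0, fun f _ x => by rw [h.sphereSum_of_lt f x (by omega), zero_mul]⟩

/-- The Gram matrix of the cosine vectors is a positive multiple of the cosine matrix. -/
lemma exists_gram (h : HasClassicalParams G D b α β cc aa bb) (hb : 1 ≤ b) :
    ∃ M : ℝ, 0 < M ∧ ∀ x y, ∑ z, cosine b α β (G.dist x z) * cosine b α β (G.dist y z) =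
      M * cosine b α β (G.dist x y) := by
  choose κ hκ using h.1.exists_sphereSum_eq (-gauss b D)
  have key : ∀ x y, ∑ z, cosine b α β (G.dist x z) * cosine b α β (G.dist y z) =
      (∑ i ∈ range (D + 1), cosine b α β i * κ i) * cosine b α β (G.dist x y) := by
    intro x y
    rw [← sum_fiberwise_of_maps_to (s := univ) (t := range (D + 1)) (g := fun z => G.dist x z)
      (fun z _ => by have := h.1.2.1 x z; simp; omega), sum_mul]
    refine sum_congr rfl fun i _ => ?_
    have := hκ i _ (h.cosine_eigenvector hb y) x
    rw [G.dist_comm (u := y) (v := x)] at this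
    rw [mul_assoc, ← this, sphereSum, mul_sum]
    refine sum_congr rfl fun z hz => ?_
    rw [(mem_filter.mp hz).2]
  refine ⟨_, ?_, key⟩
  obtain ⟨x, -⟩ := h.1.2.2.1
  have h1 := key x x
  rw [SimpleGraph.dist_self, cosine, mul_one] at h1
  rw [← h1]
  refine sum_pos' (fun z _ => mul_self_nonneg _) ⟨x, mem_univ x, ?_⟩
  simp [cosine]

/-- The Delsarte clique bound. -/
lemma card_clique_le (h : HasClassicalParams G D b α β cc aa bb) (hb : 1 ≤ b) (hD : 1 ≤ D)
    {C : Finset V} (hC : ∀ x ∈ C, ∀ y ∈ C, x ≠ y → G.Adj x y) : (#C : ℝ) ≤ β + 1 := by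
  rcases C.eq_empty_or_nonempty with rfl | hne
  · have := h.sub_pos hb hD
    rw [gauss_zero] at this
    simp; linarith
  obtain ⟨M, hM, hgram⟩ := h.exists_gram hb
  have hβ : 0 < β := by simpa [gauss_zero] using h.sub_pos hb hD
  have hnonneg : 0 ≤ ∑ z, (∑ x ∈ C, cosine b α β (G.dist x z)) ^ 2 :=
    sum_nonneg fun z _ => sq_nonneg _
  have hexp : ∑ z, (∑ x ∈ C, cosine b α β (G.dist x z)) ^ 2 =
      ∑ x ∈ C, ∑ y ∈ C, M * cosine b α β (G.dist x y) := by
    simp only [sq, sum_mul_sum, ← hgram]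
    rw [sum_comm]
    exact sum_congr rfl fun x _ => sum_comm
  have hrow : ∀ x ∈ C, ∑ y ∈ C, M * cosine b α β (G.dist x y) = M * (1 - (#C - 1) / β) := by
    intro x hx
    rw [← mul_sum, ← add_sum_erase _ _ hx, SimpleGraph.dist_self,
      sum_congr rfl (g := fun _ => -1 / β)]
    · rw [sum_const, card_erase_of_mem hx, nsmul_eq_mul, Nat.cast_pred (card_pos.mpr hne), cosine]
      ring
    · intro y hy
      rw [mem_erase] at hy
      rw [SimpleGraph.dist_eq_one_iff_adj.mpr (hC x hx y hy.2 hy.1.symm)]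
      simp [cosine, gauss_zero]
  rw [hexp, sum_congr rfl hrow, sum_const, nsmul_eq_mul] at hnonneg
  have hc : (0 : ℝ) < #C := by exact_mod_cast card_pos.mpr hne
  have h1 : 0 ≤ 1 - (#C - 1) / β :=
    nonneg_of_mul_nonneg_right (nonneg_of_mul_nonneg_right hnonneg hc) hM
  have h2 := (div_le_one hβ).mp (by linarith : ((#C : ℝ) - 1) / β ≤ 1)
  linarith

end HasClassicalParams

end ClassicalParameters
section LineSystems

open scoped Classical
open Finset

/-- A set `L` of maximal cliques, each with at least two vertices, such that every edge lies in
exactly one member of `L`. -/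
structure IsLineSystem (G : SimpleGraph V) (L : Finset (Finset V)) : Prop where
  adj : ∀ ℓ ∈ L, ∀ x ∈ ℓ, ∀ y ∈ ℓ, x ≠ y → G.Adj x y
  exists_not_adj : ∀ ℓ ∈ L, ∀ x, x ∉ ℓ → ∃ z ∈ ℓ, ¬ G.Adj x z
  exists_line : ∀ x y, G.Adj x y → ∃ ℓ ∈ L, x ∈ ℓ ∧ y ∈ ℓ
  eq_of_mem : ∀ ℓ ∈ L, ∀ m ∈ L, ∀ x y, x ≠ y → x ∈ ℓ → y ∈ ℓ → x ∈ m → y ∈ m → ℓ = m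
  two_le_card : ∀ ℓ ∈ L, 2 ≤ #ℓ

/-- The lines through `x`. -/
noncomputable def linesAt (L : Finset (Finset V)) (x : V) : Finset (Finset V) :=
  {ℓ ∈ L | x ∈ ℓ}

/-- The lines through `x` all of whose points are at distance at most two from `y`. -/
noncomputable def closeLines (G : SimpleGraph V) (L : Finset (Finset V)) (x y : V) :
    Finset (Finset V) :=
  {ℓ ∈ linesAt L x | ∀ u ∈ ℓ, G.dist y u ≤ 2}

/-- Any two points of the two lines are at distance at most two. -/
def LinesClose (G : SimpleGraph V) (ℓ m : Finset V) : Prop :=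
  ∀ u ∈ ℓ, ∀ p ∈ m, G.dist u p ≤ 2

lemma mem_linesAt {L : Finset (Finset V)} {x : V} {ℓ : Finset V} :
    ℓ ∈ linesAt L x ↔ ℓ ∈ L ∧ x ∈ ℓ := by
  simp [linesAt]

lemma mem_closeLines {G : SimpleGraph V} {L : Finset (Finset V)} {x y : V} {ℓ : Finset V} :
    ℓ ∈ closeLines G L x y ↔ (ℓ ∈ L ∧ x ∈ ℓ) ∧ ∀ u ∈ ℓ, G.dist y u ≤ 2 := by
  simp [closeLines, mem_linesAt]

lemma closeLines_subset {G : SimpleGraph V} {L : Finset (Finset V)} {x y : V} :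
    closeLines G L x y ⊆ linesAt L x :=
  filter_subset _ _

namespace IsLineSystem

variable {G : SimpleGraph V} {L : Finset (Finset V)}

lemma dist_le_one (hL : IsLineSystem G L) {ℓ : Finset V} (hℓ : ℓ ∈ L) {x y : V} (hx : x ∈ ℓ)
    (hy : y ∈ ℓ) : G.dist x y ≤ 1 := by
  by_cases h : x = y
  · simp [h]
  · exact (SimpleGraph.dist_eq_one_iff_adj.mpr (hL.adj ℓ hℓ x hx y hy h)).le

lemma not_mem_of_ne (hL : IsLineSystem G L) {ℓ m : Finset V} (hℓ : ℓ ∈ L) (hm : m ∈ L)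
    (hne : m ≠ ℓ) {x y : V} (hxy : x ≠ y) (hx : x ∈ ℓ) (hy : y ∈ ℓ) (hxm : x ∈ m) : y ∉ m :=
  fun hym => hne (hL.eq_of_mem m hm ℓ hℓ x y hxy hxm hym hx hy)

/-- The neighbours of `u` on a line `ℓ` give lines of `closeLines G L u z` for `z ∈ ℓ`. -/
lemma card_adj_le_card_closeLines (hL : IsLineSystem G L) (hG : G.Connected) {ℓ : Finset V}
    (hℓ : ℓ ∈ L) {u z : V} (hu : u ∉ ℓ) (hz : z ∈ ℓ) :
    #{p ∈ ℓ | G.Adj u p} ≤ #(closeLines G L u z) := by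
  choose! F hF using fun p => hL.exists_line u p
  refine card_le_card_of_injOn F ?_ ?_
  · intro p hp
    simp only [coe_filter, Set.mem_ofPred_eq] at hp
    obtain ⟨h1, h2, h3⟩ := hF p hp.2
    simp only [SetLike.mem_coe, mem_closeLines]
    refine ⟨⟨h1, h2⟩, fun v hv => ?_⟩
    have := hG.dist_triangle (u := z) (v := p) (w := v)
    have := hL.dist_le_one hℓ hz hp.1
    have := hL.dist_le_one h1 h3 hv
    omega
  · intro p hp q hq hpq
    simp only [coe_filter, Set.mem_ofPred_eq] at hp hq
    by_contra hne
    obtain ⟨h1, h2, h3⟩ := hF p hp.2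
    have h4 := (hF q hq.2).2.2
    rw [← hpq] at h4
    exact hu (hL.eq_of_mem _ h1 ℓ hℓ p q hne h3 h4 hp.1 hq.1 ▸ h2)

/-- The lines through `x` all of whose points are close to all the points of a line `m` at
distance one from `x`. -/
lemma card_lines_close_to_line (hL : IsLineSystem G L) (hG : G.Connected) {b q K : ℕ}
    (hdeg : ∀ x, b + 1 ≤ #(linesAt L x)) (hs : ∀ x, #(linesAt L x) ≤ b + q)
    (hclose : ∀ x y, G.dist x y = 2 → #(closeLines G L x y) = b + 1)
    (hfar : ∀ ℓ ∈ L, ∀ z ∈ ℓ, ∀ y, G.dist y z = 3 → #{p ∈ ℓ | G.dist y p ≤ 2} ≤ K + 1)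
    (hsize : ∀ ℓ ∈ L, K * q + 1 < #ℓ) {m : Finset V} (hm : m ∈ L) {x z : V} (hx : x ∉ m)
    (hz : z ∈ m) (hxz : G.Adj x z) :
    #{ℓ ∈ linesAt L x | LinesClose G ℓ m} = b + 1 := by
  have hxz1 := SimpleGraph.dist_eq_one_iff_adj.mpr hxz
  refine le_antisymm ?_ ?_
  · obtain ⟨p, hp, hxp⟩ := hL.exists_not_adj m hm x hx
    have hne : x ≠ p := fun h => hx (h ▸ hp)
    have h1 := hG.one_lt_dist_of_ne_of_not_adj hne hxp
    have h2 := hG.dist_triangle (u := x) (v := z) (w := p)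
    have h3 := hL.dist_le_one hm hz hp
    rw [← hclose x p (by omega)]
    refine card_le_card fun ℓ hℓ => ?_
    rw [mem_filter, mem_linesAt] at hℓ
    exact mem_closeLines.mpr ⟨hℓ.1, fun u hu => G.dist_comm (u := p) ▸ hℓ.2 u hu p hp⟩
  · by_contra! hlt
    have hcard := card_filter_add_card_filter_not (s := linesAt L x)
      (fun ℓ => LinesClose G ℓ m)
    have hdx := hdeg x
    have hsx := hs x
    obtain ⟨F, hFsub, hFcard⟩ := exists_subset_card_eq (n := #(linesAt L x) - b)
      (s := {ℓ ∈ linesAt L x | ¬ LinesClose G ℓ m}) (by omega)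
    have hF : ∀ ℓ ∈ F, ∃ u ∈ ℓ, ∃ p ∈ m, 2 < G.dist u p := by
      intro ℓ hℓ
      have := (mem_filter.mp (hFsub hℓ)).2
      unfold LinesClose at this
      push Not at this
      exact this
    have hFL : ∀ ℓ ∈ F, ℓ ∈ linesAt L x := fun ℓ hℓ => (mem_filter.mp (hFsub hℓ)).1
    have : Nonempty V := ⟨x⟩
    choose! w hwℓ p hpm hwp using hF
    have hclose_z : ∀ ℓ ∈ F, G.dist (w ℓ) z ≤ 2 := by
      intro ℓ hℓ
      have h1 := mem_linesAt.mp (hFL ℓ hℓ)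
      have h2 := hG.dist_triangle (u := w ℓ) (v := x) (w := z)
      have h3 := hL.dist_le_one h1.1 (hwℓ ℓ hℓ) h1.2
      omega
    have hbad : #(F.biUnion fun ℓ => {p' ∈ m.erase z | G.dist (w ℓ) p' ≤ 2}) ≤ #F * K := by
      refine card_biUnion_le_card_mul _ _ _ fun ℓ hℓ => ?_
      have h1 := hG.dist_triangle (u := w ℓ) (v := z) (w := p ℓ)
      have h2 := hL.dist_le_one hm hz (hpm ℓ hℓ)
      have h3 := hclose_z ℓ hℓ
      have h4 := hwp ℓ hℓ
      have h5 := hfar m hm (p ℓ) (hpm ℓ hℓ) (w ℓ) (by omega)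
      have h6 : #{p' ∈ m.erase z | G.dist (w ℓ) p' ≤ 2} < #{p' ∈ m | G.dist (w ℓ) p' ≤ 2} := by
        refine card_lt_card (ssubset_iff_of_subset ?_ |>.mpr ⟨z, ?_, ?_⟩)
        · exact filter_subset_filter _ (erase_subset z m)
        · exact mem_filter.mpr ⟨hz, h3⟩
        · simp
      omega
    have hlt' : #(F.biUnion fun ℓ => {p' ∈ m.erase z | G.dist (w ℓ) p' ≤ 2}) < #(m.erase z) := by
      refine hbad.trans_lt ?_
      rw [card_erase_of_mem hz]
      have h1 := hsize m hm
      have h2 : #F * K ≤ K * q := by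
        rw [mul_comm]; exact Nat.mul_le_mul_left K (by omega)
      omega
    obtain ⟨p', hp'm, hp'⟩ := exists_mem_notMem_of_card_lt_card hlt'
    have hfar' : ∀ ℓ ∈ F, 2 < G.dist (w ℓ) p' := by
      intro ℓ hℓ
      by_contra! hle
      exact hp' (mem_biUnion.mpr ⟨ℓ, hℓ, mem_filter.mpr ⟨hp'm, hle⟩⟩)
    obtain ⟨ℓ₀, hℓ₀⟩ : F.Nonempty := card_pos.mp (by omega)
    have hx0 := mem_linesAt.mp (hFL ℓ₀ hℓ₀)
    have h1 := hG.dist_triangle (u := w ℓ₀) (v := x) (w := p')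
    have h2 := hL.dist_le_one hx0.1 (hwℓ ℓ₀ hℓ₀) hx0.2
    have h3 := hfar' ℓ₀ hℓ₀
    have h4 := hG.dist_triangle (u := x) (v := z) (w := p')
    have h5 := hL.dist_le_one hm hz (mem_of_mem_erase hp'm)
    have hsub : closeLines G L x p' ⊆ linesAt L x \ F := by
      intro ℓ hℓ
      rw [mem_closeLines] at hℓ
      refine mem_sdiff.mpr ⟨mem_linesAt.mpr hℓ.1, fun hmem => ?_⟩
      have h6 := hfar' ℓ hmem
      have h7 := hℓ.2 _ (hwℓ ℓ hmem)
      rw [G.dist_comm] at h7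
      omega
    have h8 := card_le_card hsub
    rw [hclose x p' (by omega), card_sdiff_of_subset hFL, hFcard] at h8
    omega

lemma card_linesAt_eq_of_adj (hL : IsLineSystem G L) (hG : G.Connected) {b q K : ℕ} (hb : 1 ≤ b)
    (hdeg : ∀ x, b + 1 ≤ #(linesAt L x)) (hs : ∀ x, #(linesAt L x) ≤ b + q)
    (hclose : ∀ x y, G.dist x y = 2 → #(closeLines G L x y) = b + 1)
    (hfar : ∀ ℓ ∈ L, ∀ z ∈ ℓ, ∀ y, G.dist y z = 3 → #{p ∈ ℓ | G.dist y p ≤ 2} ≤ K + 1)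
    (hsize : ∀ ℓ ∈ L, K * q + 1 < #ℓ) {x z : V} (hxz : G.Adj x z) :
    #(linesAt L x) = #(linesAt L z) := by
  obtain ⟨ℓ, hℓ, hxℓ, hzℓ⟩ := hL.exists_line x z hxz
  have key : ∀ {x z : V}, G.Adj x z → x ∈ ℓ → z ∈ ℓ → ∀ m ∈ (linesAt L z).erase ℓ,
      #{k ∈ (linesAt L x).erase ℓ | LinesClose G k m} = b := by
    intro x z hxz hxℓ hzℓ m hm
    rw [mem_erase, mem_linesAt] at hm
    have hxm : x ∉ m := hL.not_mem_of_ne hℓ hm.2.1 hm.1 hxz.ne' hzℓ hxℓ hm.2.2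
    have h1 := hL.card_lines_close_to_line hG hdeg hs hclose hfar hsize hm.2.1 hxm hm.2.2 hxz
    rw [filter_erase, card_erase_of_mem, h1, Nat.add_sub_cancel]
    refine mem_filter.mpr ⟨mem_linesAt.mpr ⟨hℓ, hxℓ⟩, fun u hu p hp => ?_⟩
    have h2 := hG.dist_triangle (u := u) (v := z) (w := p)
    have h3 := hL.dist_le_one hℓ hu hzℓ
    have h4 := hL.dist_le_one hm.2.1 hm.2.2 hp
    omega
  have hcount := card_mul_eq_card_mul (s := (linesAt L x).erase ℓ) (t := (linesAt L z).erase ℓ)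
    (LinesClose G) (m := b) (n := b) ?_ ?_
  · rw [card_erase_of_mem (mem_linesAt.mpr ⟨hℓ, hxℓ⟩),
      card_erase_of_mem (mem_linesAt.mpr ⟨hℓ, hzℓ⟩)] at hcount
    have h1 := Nat.eq_of_mul_eq_mul_right hb hcount
    have := hdeg x
    have := hdeg z
    omega
  · intro k hk
    rw [← key hxz.symm hzℓ hxℓ k hk, bipartiteAbove]
    congr 1
    refine filter_congr fun m _ => ?_
    exact ⟨fun h u hu p hp => G.dist_comm (u := p) ▸ h p hp u hu,
      fun h u hu p hp => G.dist_comm (u := p) ▸ h p hp u hu⟩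
  · intro m hm
    exact key hxz hxℓ hzℓ m hm

variable [Fintype V]

lemma sum_adj {M : Type*} [AddCommMonoid M] (hL : IsLineSystem G L) (x : V) (f : V → M) :
    ∑ p with G.Adj x p, f p = ∑ ℓ ∈ linesAt L x, ∑ p ∈ ℓ.erase x, f p := by
  rw [← sum_biUnion]
  · refine sum_congr ?_ fun _ _ => rfl
    ext p
    simp only [mem_filter, mem_univ, true_and, mem_biUnion, mem_linesAt, mem_erase]
    constructor
    · intro h
      obtain ⟨ℓ, h1, h2, h3⟩ := hL.exists_line x p h
      exact ⟨ℓ, ⟨h1, h2⟩, h.ne', h3⟩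
    · rintro ⟨ℓ, ⟨h1, h2⟩, h3, h4⟩
      exact hL.adj ℓ h1 x h2 p h4 h3.symm
  · intro ℓ hℓ m hm hne
    simp only [SetLike.mem_coe, mem_linesAt] at hℓ hm
    refine disjoint_left.mpr fun p hp hp' => hne ?_
    rw [mem_erase] at hp hp'
    exact hL.eq_of_mem ℓ hℓ.1 m hm.1 x p hp.1.symm hℓ.2 hp.2 hm.2 hp'.2

lemma card_adj (hL : IsLineSystem G L) (x : V) (P : V → Prop)
    [DecidablePred P] : #{p | G.Adj x p ∧ P p} = ∑ ℓ ∈ linesAt L x, #{p ∈ ℓ.erase x | P p} := by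
  have := hL.sum_adj x (fun p => if P p then 1 else 0)
  simp only [card_filter, ← this, ← filter_filter]

lemma valency_eq_sum (hL : IsLineSystem G L) (x : V) :
    #{p | G.Adj x p} = ∑ ℓ ∈ linesAt L x, (#ℓ - 1) := by
  rw [card_eq_sum_ones, hL.sum_adj]
  refine sum_congr rfl fun ℓ hℓ => ?_
  rw [← card_eq_sum_ones, card_erase_of_mem (mem_linesAt.mp hℓ).2]

variable {D : ℕ} {cc aa bb : ℕ → ℕ}

lemma le_card_line (hL : IsLineSystem G L) (h : IsDRG G D cc aa bb) (hD : 1 ≤ D) {n s : ℕ}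
    (hn : ∀ ℓ ∈ L, ∀ u, u ∉ ℓ → #{p ∈ ℓ | G.Adj u p} ≤ n + 1) (hs : ∀ x, #(linesAt L x) ≤ s)
    {ℓ : Finset V} (hℓ : ℓ ∈ L) : aa 1 + 2 ≤ #ℓ + n * (s - 1) := by
  obtain ⟨x, hx, y, hy, hxy⟩ := one_lt_card.mp (hL.two_le_card ℓ hℓ)
  have hadj := hL.adj ℓ hℓ x hx y hy hxy
  have ha := h.card_a hD (SimpleGraph.dist_eq_one_iff_adj.mpr hadj.symm)
  simp only [SimpleGraph.dist_eq_one_iff_adj] at ha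
  have hmem : ℓ ∈ linesAt L x := mem_linesAt.mpr ⟨hℓ, hx⟩
  rw [hL.card_adj x (G.Adj y), ← add_sum_erase _ _ hmem] at ha
  have hself : #{p ∈ ℓ.erase x | G.Adj y p} ≤ #ℓ - 2 := by
    have hsub : {p ∈ ℓ.erase x | G.Adj y p} ⊆ (ℓ.erase x).erase y := by
      intro p hp
      rw [mem_filter] at hp
      exact mem_erase.mpr ⟨hp.2.ne', hp.1⟩
    refine (card_le_card hsub).trans ?_
    rw [card_erase_of_mem (mem_erase.mpr ⟨hxy.symm, hy⟩), card_erase_of_mem hx]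
    omega
  have hother : ∑ m ∈ (linesAt L x).erase ℓ, #{p ∈ m.erase x | G.Adj y p} ≤ (s - 1) * n := by
    refine (sum_le_card_nsmul _ _ n fun m hm => ?_).trans ?_
    · rw [mem_erase, mem_linesAt] at hm
      have hym := hL.not_mem_of_ne hℓ hm.2.1 hm.1 hxy hx hy hm.2.2
      have hlt : #{p ∈ m.erase x | G.Adj y p} < #{p ∈ m | G.Adj y p} := by
        refine card_lt_card (ssubset_iff_of_subset ?_ |>.mpr ⟨x, ?_, ?_⟩)
        · exact filter_subset_filter _ (erase_subset x m)
        · exact mem_filter.mpr ⟨hm.2.2, hadj.symm⟩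
        · simp
      have := hn m hm.2.1 y hym
      omega
    · rw [card_erase_of_mem hmem, smul_eq_mul]
      exact Nat.mul_le_mul_right n (Nat.sub_le_sub_right (hs x) 1)
  have := hL.two_le_card ℓ hℓ
  rw [mul_comm n]
  omega

lemma sum_closeLines (hL : IsLineSystem G L) (h : IsDRG G D cc aa bb) (hD : 2 ≤ D) {x y : V}
    (hxy : G.dist y x = 2) :
    ∑ ℓ ∈ closeLines G L x y, (#ℓ - 1) +
      ∑ ℓ ∈ linesAt L x \ closeLines G L x y, #{p ∈ ℓ.erase x | G.dist y p ≤ 2} =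
        cc 2 + aa 2 := by
  have hsplit : #{p | G.Adj x p ∧ G.dist y p ≤ 2} = cc 2 + aa 2 := by
    rw [← h.card_c hD hxy, ← h.card_a hD hxy, ← card_union_of_disjoint]
    · congr 1
      ext p
      simp only [mem_filter, mem_univ, true_and, mem_union]
      constructor
      · rintro ⟨h1, h2⟩
        have := dist_le_succ_of_adj h.1 (x := y) h1.symm
        have : G.dist y p = 1 ∨ G.dist y p = 2 := by omega
        tauto
      · rintro (⟨h1, h2⟩ | ⟨h1, h2⟩) <;> exact ⟨h1, by omega⟩
    · refine disjoint_left.mpr fun p hp hp' => ?_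
      simp only [mem_filter] at hp hp'
      omega
  rw [← hsplit, hL.card_adj, ← sum_sdiff (closeLines_subset (G := G) (L := L) (x := x) (y := y)),
    add_comm]
  congr 1
  refine sum_congr rfl fun ℓ hℓ => ?_
  rw [mem_closeLines] at hℓ
  rw [filter_true_of_mem fun p hp => hℓ.2 p (mem_of_mem_erase hp), card_erase_of_mem hℓ.1.2]

/-- A line with a point at distance three from `y` has few points at distance two from `y`. -/
lemma card_close_mul_le (hL : IsLineSystem G L) (h : IsDRG G D cc aa bb) (hD : 3 ≤ D) {n : ℕ}
    (hn : ∀ ℓ ∈ L, ∀ u, u ∉ ℓ → #{p ∈ ℓ | G.Adj u p} ≤ n) {ℓ : Finset V} (hℓ : ℓ ∈ L) {y z : V}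
    (hz : z ∈ ℓ) (hyz : G.dist y z = 3) : #{p ∈ ℓ | G.dist y p ≤ 2} * cc 2 ≤ cc 3 * n := by
  have hdist : ∀ p ∈ ℓ, 2 ≤ G.dist y p := by
    intro p hp
    have := h.1.dist_triangle (u := y) (v := p) (w := z)
    have := hL.dist_le_one hℓ hp hz
    omega
  rw [← h.card_c hD (G.dist_comm.trans hyz : G.dist z y = 3)]
  refine card_mul_le_card_mul (fun p u => G.Adj u p) ?_ ?_
  · intro p hp
    rw [mem_filter] at hp
    have hp2 : G.dist y p = 2 := le_antisymm hp.2 (hdist p hp.1)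
    rw [← h.card_c (by omega) hp2]
    refine card_le_card fun u hu => ?_
    simp only [mem_filter, mem_univ, true_and] at hu
    simp only [bipartiteAbove, mem_filter, mem_univ, true_and]
    refine ⟨⟨SimpleGraph.dist_eq_one_iff_adj.mp hu.2, ?_⟩, hu.1.symm⟩
    have h1 := h.1.dist_triangle (u := y) (v := u) (w := z)
    have h2 := h.1.dist_triangle (u := u) (v := p) (w := z)
    have h3 := hL.dist_le_one hℓ hp.1 hz
    rw [SimpleGraph.dist_eq_one_iff_adj.mpr hu.1.symm] at h2
    rw [G.dist_comm (u := z)]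
    omega
  · intro u hu
    simp only [mem_filter, mem_univ, true_and] at hu
    have huℓ : u ∉ ℓ := by
      intro hmem
      have := hdist u hmem
      rw [SimpleGraph.dist_eq_one_iff_adj.mpr hu.1] at this
      omega
    refine (card_le_card ?_).trans (hn ℓ hℓ u huℓ)
    intro p hp
    simp only [bipartiteBelow, mem_filter] at hp ⊢
    exact ⟨hp.1.1, hp.2⟩

/-- If every point lies on exactly `t` lines and every line has more than `t` points, then
`-t` is an eigenvalue. -/
lemma exists_eigenvector [Nonempty V] (hL : IsLineSystem G L) {t : ℕ}
    (ht : ∀ x, #(linesAt L x) = t) (hsize : ∀ ℓ ∈ L, t < #ℓ) :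
    ∃ f : V → ℝ, f ≠ 0 ∧ ∀ y, ∑ z with G.Adj y z, f z = -(t : ℝ) * f y := by
  have hcount := card_mul_le_card_mul (s := L) (t := (univ : Finset V)) (fun ℓ x => x ∈ ℓ)
    (m := t + 1) (n := t)
    (fun ℓ hℓ => (hsize ℓ hℓ).trans_le (card_le_card fun x hx => by simpa [bipartiteAbove] using hx))
    (fun x _ => (ht x).le)
  have hV : 0 < #(univ : Finset V) := card_pos.mpr univ_nonempty
  have hlt : #L < Fintype.card V := by
    rw [← card_univ]
    by_contra! hle
    have := Nat.mul_le_mul_right (t + 1) hle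
    nlinarith
  let φ : (V → ℝ) →ₗ[ℝ] (L → ℝ) :=
    LinearMap.pi fun ℓ => ∑ p ∈ (ℓ : Finset V), LinearMap.proj p
  have hker : LinearMap.ker φ ≠ ⊥ := LinearMap.ker_ne_bot_of_finrank_lt (by simpa using hlt)
  obtain ⟨f, hf, hf0⟩ := Submodule.exists_mem_ne_zero_of_ne_bot hker
  refine ⟨f, hf0, fun y => ?_⟩
  have hzero : ∀ ℓ ∈ L, ∑ p ∈ ℓ, f p = 0 := by
    intro ℓ hℓ
    have := congrFun (LinearMap.mem_ker.mp hf) ⟨ℓ, hℓ⟩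
    simpa [φ] using this
  rw [hL.sum_adj, sum_congr rfl (g := fun _ => -f y), sum_const, ht, nsmul_eq_mul]
  · ring
  · intro ℓ hℓ
    rw [mem_linesAt] at hℓ
    have := add_sum_erase ℓ f hℓ.2
    rw [hzero ℓ hℓ.1] at this
    linarith

end IsLineSystem

end LineSystems
section Numerics

/-- The numerical contradiction showing that a point off a line has at most `b + 1` neighbours
on it. -/
lemma false_of_many_neighbors {b n c s : ℕ} {α Y : ℝ} (hb : 2 ≤ b) (hs : 2 ≤ s) (hn : b + 2 ≤ n)
    (hnc : n ≤ c) (hc : (c : ℝ) = (b + 1) * (1 + α)) (hY : (2 * (s : ℝ) - 1) * (c - 1) + 1 ≤ Y)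
    (h1 : ((b : ℝ) + 2) * (b + 1) * (s - 1) < Y + b * (b + 1) * α)
    (h : n * (Y - (n - 1) * (s - 1)) ≤ (b + 1) * (Y - α * b)) : False := by
  have hα : (b + 1) * α = c - b - 1 := by linarith
  have hbα : b * (b + 1) * α = b * (c - b - 1) := by rw [← hα]; ring
  have hbR : (2 : ℝ) ≤ b := by exact_mod_cast hb
  have hsR : (2 : ℝ) ≤ s := by exact_mod_cast hs
  have hnR : (b : ℝ) + 2 ≤ n := by exact_mod_cast hn
  have hncR : (n : ℝ) ≤ c := by exact_mod_cast hnc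
  rw [hbα] at h1
  have h' : 0 ≤ n * (n - 1) * ((s : ℝ) - 1) - (n - b - 1) * Y - b * (c - b - 1) := by
    rw [← hbα]; linarith
  obtain ⟨S, hS⟩ : ∃ S : ℝ, S = s - 1 := ⟨_, rfl⟩
  rw [← hS] at h' h1
  have hS1 : 1 ≤ S := by linarith
  have hs' : (s : ℝ) = S + 1 := by linarith
  rw [hs'] at hY
  have hfc : (c : ℝ) * (c - 1) * S - (c - b - 1) * Y - b * (c - b - 1) < 0 := by
    rcases le_or_gt (2 * b + 2) c with hcb | hcb
    · have hcR : (2 : ℝ) * b + 2 ≤ c := by exact_mod_cast hcb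
      have h2 : (c : ℝ) - b - 1 ≥ c / 2 := by linarith
      have h3 : 2 * S * (c - 1) < Y + b := by nlinarith
      have h4 : 0 ≤ 2 * S * ((c : ℝ) - 1) := by
        have : 0 ≤ (c : ℝ) - 1 := by linarith
        positivity
      have h5 := mul_le_mul_of_nonneg_right h2 (h4.trans h3.le)
      have h6 := mul_lt_mul_of_pos_left h3 (by linarith : 0 < (c : ℝ) / 2)
      linarith
    · have hcR : (c : ℝ) ≤ 2 * b + 1 := by exact_mod_cast (by omega : c ≤ 2 * b + 1)
      obtain ⟨j, hj⟩ : ∃ j : ℝ, j = c - b - 1 := ⟨_, rfl⟩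
      have hj1 : 1 ≤ j := by linarith
      have hjb : j ≤ b := by linarith
      have hcj : (c : ℝ) = j + b + 1 := by linarith
      rw [← hj] at h1 ⊢
      rw [hcj]
      have h2 : 0 ≤ S * (b ^ 2 + b - j) - b * j := by nlinarith
      nlinarith [mul_nonneg (by linarith : 0 ≤ j - 1) h2, mul_lt_mul_of_pos_left h1
        (by linarith : 0 < j)]
  have hc2 : 0 ≤ (c : ℝ) - b - 2 := by linarith
  rcases hncR.eq_or_lt with heq | hlt
  · rw [heq] at h'; linarith
  · rcases hnR.eq_or_lt with heq' | hlt'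
    · rw [← heq'] at h'; linarith
    · have h2 := mul_neg_of_neg_of_pos hfc (by linarith : 0 < (n : ℝ) - b - 2)
      have h3 := mul_neg_of_neg_of_pos
        (by linarith : ((b : ℝ) + 2) * (b + 1) * S - (Y + b * (c - b - 1)) < 0)
        (by linarith : 0 < (c : ℝ) - n)
      have h4 := mul_nonneg h' (by linarith : 0 ≤ (c : ℝ) - b - 2)
      have h5 : 0 ≤ ((c : ℝ) - n) * (n - b - 2) * (c - b - 2) * S := by
        have : 0 ≤ (n : ℝ) - b - 2 := by linarith
        have : 0 ≤ (c : ℝ) - n := by linarith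
        positivity
      linarith

/-- The numerical contradiction showing that at least `b + 1` lines through a point are close to
a point at distance two. -/
lemma false_of_few_close_lines {b g t s K α β r : ℝ} (hb : 2 ≤ b) (hK : 0 ≤ K) (hg : g ≤ b)
    (hg0 : 0 ≤ g) (ht : t ≤ s) (hs : b + 2 ≤ s) (hαβ : α * (b + 1) ≤ β)
    (h2 : K * (s - b) - α * (b + 1) * r + α * (b + 1) ^ 2 < β)
    (h3 : K * (s - b) + b * (s - 1) < β + α * (r - 1))
    (h : (b + 1) * (β + α * (r - 1) - α * b) ≤ g * β + (t - g) * K) : False := by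
  have hle : g * β + (t - g) * K ≤ s * K + g * (β - K) := by nlinarith
  rcases le_or_gt K β with hKβ | hKβ
  · nlinarith
  · have h4 : g * (β - K) ≤ 0 := by nlinarith
    have h5 : (b + 1) * (α * b) ≤ b * K := by nlinarith
    have h6 := mul_lt_mul_of_pos_left h3 (by linarith : 0 < b + 1)
    have h7 := mul_nonneg (mul_nonneg hK (by linarith : 0 ≤ b)) (by linarith : 0 ≤ s - b - 2)
    have h8 : 0 ≤ (b + 1) * (b * (s - 1)) :=
      mul_nonneg (by linarith) (mul_nonneg (by linarith) (by linarith))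
    linarith

end Numerics

section MainArgument

open scoped Classical
open Finset

variable [Fintype V] {G : SimpleGraph V} {D b : ℕ} {α β : ℝ} {cc aa bb : ℕ → ℕ}

lemma HasSPLS.exists_lineSystem {a c s : ℕ} (h : HasSPLS G a c s) :
    ∃ L : Finset (Finset V), IsLineSystem G L ∧ (∀ x, #(linesAt L x) ≤ s) ∧
      (∀ ℓ ∈ L, ∀ u, u ∉ ℓ → #{p ∈ ℓ | G.Adj u p} ≤ c) ∧
      ∀ ℓ : Finset V, ℓ ∈ L ↔ (ℓ : Set V) ∈ splsLines G a c s := by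
  obtain ⟨hc, hs, ha, hpoint, hdeg, hnbr⟩ := h
  have hmem : ∀ ℓ : Finset V, ℓ ∈ ({ℓ | (ℓ : Set V) ∈ splsLines G a c s} : Finset (Finset V)) ↔
      (ℓ : Set V) ∈ splsLines G a c s := by simp
  refine ⟨({ℓ | (ℓ : Set V) ∈ splsLines G a c s} : Finset (Finset V)), ⟨?_, ?_, ?_, ?_, ?_⟩,
    ?_, ?_, hmem⟩
  · intro ℓ hℓ x hx y hy hxy
    exact ((hmem ℓ).mp hℓ).1.1 hx hy hxy
  · intro ℓ hℓ x hx
    by_contra! hadj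
    have hmax := ((hmem ℓ).mp hℓ).1
    have := hmax.2 (insert x ℓ) (hmax.1.insert fun y hy _ => hadj y hy) (Set.subset_insert _ _)
    have hxs : x ∈ (ℓ : Set V) := this ▸ Set.mem_insert x _
    exact hx hxs
  · intro x y hxy
    obtain ⟨ℓ, ⟨hℓ, hx, hy⟩, -⟩ := hpoint x y hxy
    exact ⟨ℓ.toFinset, (hmem _).mpr (by simpa using hℓ), by simpa using hx, by simpa using hy⟩
  · intro ℓ hℓ m hm x y hxy hxℓ hyℓ hxm hym
    have hℓ' := (hmem ℓ).mp hℓ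
    exact coe_injective ((hpoint x y (hℓ'.1.1 hxℓ hyℓ hxy)).unique ⟨hℓ', hxℓ, hyℓ⟩
      ⟨(hmem m).mp hm, hxm, hym⟩)
  · intro ℓ hℓ
    have h1 := ((hmem ℓ).mp hℓ).2
    rw [Set.ncard_coe_finset] at h1
    have hc' : (1 : ℤ) ≤ c := by exact_mod_cast hc
    have hs' : (2 : ℤ) ≤ s := by exact_mod_cast hs
    have : (2 : ℤ) ≤ #ℓ := by nlinarith
    exact_mod_cast this
  · intro x
    refine le_trans ?_ (hdeg x)
    rw [← card_image_of_injective _ (coe_injective (α := V)), ← Set.ncard_coe_finset]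
    refine Set.ncard_le_ncard ?_ (Set.toFinite _)
    intro m hm
    obtain ⟨ℓ, hℓ, rfl⟩ := mem_image.mp (mem_coe.mp hm)
    rw [mem_linesAt, hmem] at hℓ
    exact hℓ
  · intro ℓ hℓ u hu
    have := hnbr ℓ ((hmem ℓ).mp hℓ) u hu
    rwa [← Set.ncard_coe_finset, coe_filter]

namespace HasClassicalParams

lemma a_one_add_one (h : HasClassicalParams G D b α β cc aa bb) (hD : 1 ≤ D) :
    (aa 1 : ℝ) + 1 = β + α * (gauss b D - 1) := by
  have := h.a_eq hD
  simp only [gauss_one, Nat.sub_self, gauss_zero] at this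
  linarith

lemma c_two_add_a_two (h : HasClassicalParams G D b α β cc aa bb) (hD : 2 ≤ D) :
    (cc 2 : ℝ) + aa 2 = (b + 1) * (β + α * (gauss b D - 1) - α * b) := by
  have h1 := h.1.sum_params hD
  have h2 := h.b_eq hD
  rw [gauss_two] at h2
  rw [h2, h.valency_eq] at h1
  linarith

lemma card_linesAt_ge (h : HasClassicalParams G D b α β cc aa bb) (hb : 1 ≤ b) (hD : 1 ≤ D)
    {L : Finset (Finset V)} (hL : IsLineSystem G L) (x : V) :
    gauss b D ≤ #(linesAt L x) := by
  have hβ : 0 < β := by simpa [gauss_zero] using h.sub_pos hb (i := 0) hD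
  have hsum : (bb 0 : ℝ) ≤ #(linesAt L x) * β := by
    rw [← h.1.card_neighbors x, hL.valency_eq_sum x, Nat.cast_sum, ← nsmul_eq_mul]
    refine sum_le_card_nsmul _ _ _ fun ℓ hℓ => ?_
    have hℓL := (mem_linesAt.mp hℓ).1
    have := h.card_clique_le hb hD (hL.adj ℓ hℓL)
    have := hL.two_le_card ℓ hℓL
    push_cast [Nat.cast_sub (by omega : 1 ≤ #ℓ)]
    linarith
  rw [h.valency_eq] at hsum
  exact le_of_mul_le_mul_right hsum hβ

/-- If there are at most `[D]` lines at each point, then every line has `β + 1` points. -/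
lemma card_line_eq (h : HasClassicalParams G D b α β cc aa bb) (hb : 1 ≤ b) (hD : 1 ≤ D)
    {L : Finset (Finset V)} (hL : IsLineSystem G L)
    (ht : ∀ x, (#(linesAt L x) : ℝ) ≤ gauss b D) {ℓ : Finset V} (hℓ : ℓ ∈ L) :
    (#ℓ : ℝ) = β + 1 := by
  have hle : ∀ m ∈ L, ((#m - 1 : ℕ) : ℝ) ≤ β := by
    intro m hm
    have := h.card_clique_le hb hD (hL.adj m hm)
    have := hL.two_le_card m hm
    push_cast [Nat.cast_sub (by omega : 1 ≤ #m)]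
    linarith
  have h2 := hL.two_le_card ℓ hℓ
  obtain ⟨x, hx⟩ : ℓ.Nonempty := card_pos.mp (by omega)
  have hβ : 0 < β := by simpa [gauss_zero] using h.sub_pos hb (i := 0) hD
  by_contra hne
  have hlt : ((#ℓ - 1 : ℕ) : ℝ) < β := by
    refine (hle ℓ hℓ).lt_of_ne fun heq => hne ?_
    rw [Nat.cast_sub (by omega : 1 ≤ #ℓ)] at heq
    push_cast at heq
    linarith
  have hsum : (bb 0 : ℝ) < #(linesAt L x) * β := by
    rw [← h.1.card_neighbors x, hL.valency_eq_sum x, Nat.cast_sum, ← nsmul_eq_mul, ← sum_const]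
    exact sum_lt_sum (fun m hm => hle m (mem_linesAt.mp hm).1)
      ⟨ℓ, mem_linesAt.mpr ⟨hℓ, hx⟩, hlt⟩
  rw [h.valency_eq] at hsum
  exact absurd (lt_of_mul_lt_mul_right hsum hβ.le) (not_lt.mpr (ht x))

/-- A lower bound for the number of points close to a point at distance two. -/
lemma card_closeLines_mul_le (h : HasClassicalParams G D b α β cc aa bb) (hD : 2 ≤ D)
    {L : Finset (Finset V)} (hL : IsLineSystem G L) {w : ℝ} (hw : ∀ ℓ ∈ L, w + 1 ≤ #ℓ) {x y : V}
    (hxy : G.dist y x = 2) :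
    #(closeLines G L x y) * w ≤ (b + 1) * (β + α * (gauss b D - 1) - α * b) := by
  rw [← h.c_two_add_a_two hD, ← Nat.cast_add, ← hL.sum_closeLines h.1 hD hxy, Nat.cast_add,
    Nat.cast_sum, ← nsmul_eq_mul]
  refine (card_nsmul_le_sum _ _ _ fun ℓ hℓ => ?_).trans (le_add_of_nonneg_right (Nat.cast_nonneg _))
  have hℓL := (mem_closeLines.mp hℓ).1.1
  have := hw ℓ hℓL
  have := hL.two_le_card ℓ hℓL
  rw [Nat.cast_sub (by omega : 1 ≤ #ℓ)]
  push_cast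
  linarith

/-- A point off a line has at most `b + 1` neighbours on it. -/
lemma card_adj_line_le (h : HasClassicalParams G D b α β cc aa bb) (hb : 2 ≤ b) (hD : 3 ≤ D)
    {L : Finset (Finset V)} (hL : IsLineSystem G L) {s : ℕ} (hs2 : 2 ≤ s)
    (hs : ∀ x, #(linesAt L x) ≤ s)
    (hc : ∀ ℓ ∈ L, ∀ u, u ∉ ℓ → #{p ∈ ℓ | G.Adj u p} ≤ cc 2)
    (ha : (2 * (s : ℝ) - 1) * (cc 2 - 1) ≤ aa 1)
    (h1 : ((b : ℝ) + 2) * (b + 1) * (s - 1) - (b * (b + 1) + gauss b D - 1) * α < β) :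
    ∀ ℓ ∈ L, ∀ u, u ∉ ℓ → #{p ∈ ℓ | G.Adj u p} ≤ b + 1 := by
  by_contra! hex
  let P : ℕ → Prop := fun n => ∃ ℓ ∈ L, ∃ u, u ∉ ℓ ∧ #{p ∈ ℓ | G.Adj u p} = n
  have hP : ∃ n, b + 2 ≤ n ∧ n ≤ cc 2 ∧ P n := by
    obtain ⟨ℓ, hℓ, u, hu, hlt⟩ := hex
    exact ⟨_, hlt, hc ℓ hℓ u hu, ℓ, hℓ, u, hu, rfl⟩
  obtain ⟨n₀, hn₀, hn₀c, hPn₀⟩ := hP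
  have hspec := Nat.findGreatest_spec hn₀c hPn₀
  have hge := Nat.le_findGreatest hn₀c hPn₀
  have hle := Nat.findGreatest_le (P := P) (cc 2)
  have hmax : ∀ ℓ ∈ L, ∀ u, u ∉ ℓ → #{p ∈ ℓ | G.Adj u p} ≤ Nat.findGreatest P (cc 2) :=
    fun ℓ hℓ u hu => Nat.le_findGreatest (hc ℓ hℓ u hu) ⟨ℓ, hℓ, u, hu, rfl⟩
  obtain ⟨n, hn⟩ : ∃ n, n + 1 = Nat.findGreatest P (cc 2) :=
    ⟨Nat.findGreatest P (cc 2) - 1, by omega⟩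
  rw [← hn] at hspec hge hle hmax
  obtain ⟨ℓ, hℓ, u, hu, hcard⟩ := hspec
  obtain ⟨z, hz, huz⟩ := hL.exists_not_adj ℓ hℓ u hu
  obtain ⟨p, hp⟩ : ({p ∈ ℓ | G.Adj u p} : Finset V).Nonempty := card_pos.mp (by omega)
  rw [mem_filter] at hp
  have hdist : G.dist z u = 2 := by
    have h2 := h.1.1.one_lt_dist_of_ne_of_not_adj (fun e : u = z => hu (e ▸ hz)) huz
    have h3 := h.1.1.dist_triangle (u := u) (v := p) (w := z)
    have h4 := hL.dist_le_one hℓ hp.1 hz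
    have h5 := SimpleGraph.dist_eq_one_iff_adj.mpr hp.2
    rw [G.dist_comm]
    omega
  have hclose := hL.card_adj_le_card_closeLines h.1.1 hℓ hu hz
  rw [hcard] at hclose
  have hY := h.a_one_add_one (by omega)
  have hw : ∀ m ∈ L, ((aa 1 : ℝ) + 1 - n * (s - 1)) + 1 ≤ #m := by
    intro m hm
    have h2 := hL.le_card_line h.1 (by omega) hmax hs hm
    have h3 : ((aa 1 + 2 : ℕ) : ℝ) ≤ ((#m + n * (s - 1) : ℕ) : ℝ) := by exact_mod_cast h2
    push_cast [Nat.cast_sub (by omega : 1 ≤ s)] at h3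
    linarith
  have hsum := h.card_closeLines_mul_le (by omega) hL hw hdist
  have hc2 := h.c_eq (i := 1) (by omega)
  norm_num [gauss_two, gauss_one] at hc2
  have hsR : (2 : ℝ) ≤ s := by exact_mod_cast hs2
  have hnc : (n : ℝ) + 1 ≤ cc 2 := by exact_mod_cast hle
  have hb0 : (0 : ℝ) ≤ n := by positivity
  have hw0 : 0 ≤ (aa 1 : ℝ) + 1 - n * (s - 1) := by nlinarith
  have hclose' : ((n + 1 : ℕ) : ℝ) ≤ #(closeLines G L u z) := by exact_mod_cast hclose
  have hfin := (mul_le_mul_of_nonneg_right hclose' hw0).trans hsum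
  refine false_of_many_neighbors (Y := aa 1 + 1) hb hs2 (by omega) hle hc2 (by linarith) ?_ ?_
  · rw [hY]; linarith
  · rw [← hY] at hfin
    push_cast at hfin ⊢
    linarith

/-- A line with a point at distance three from `y` has few points at smaller distance. -/
lemma card_close_le (h : HasClassicalParams G D b α β cc aa bb) (hb : 1 ≤ b) (hD : 3 ≤ D)
    {L : Finset (Finset V)} (hL : IsLineSystem G L)
    (hn : ∀ ℓ ∈ L, ∀ u, u ∉ ℓ → #{p ∈ ℓ | G.Adj u p} ≤ b + 1) {ℓ : Finset V} (hℓ : ℓ ∈ L)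
    {y z : V} (hz : z ∈ ℓ) (hyz : G.dist y z = 3) :
    #{p ∈ ℓ | G.dist y p ≤ 2} < (b + 1) * (b ^ 2 + b + 1) := by
  have hle := hL.card_close_mul_le h.1 hD hn hℓ hz hyz
  have hleR : (#{p ∈ ℓ | G.dist y p ≤ 2} : ℝ) * cc 2 ≤ cc 3 * (b + 1) := by exact_mod_cast hle
  have hc2 := h.c_eq (i := 1) (by omega)
  have hc3 := h.c_eq (i := 2) (by omega)
  norm_num [gauss_two, gauss_one, gauss_three] at hc2 hc3
  rw [hc2, hc3] at hleR
  have hpos := h.one_add_pos hb (i := 1) (by omega)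
  rw [gauss_one, mul_one] at hpos
  have hbR : (1 : ℝ) ≤ b := by exact_mod_cast hb
  have hlt : (#{p ∈ ℓ | G.dist y p ≤ 2} : ℝ) * (1 + α) <
      (b + 1) * (b ^ 2 + b + 1) * (1 + α) := by
    have h1 : (#{p ∈ ℓ | G.dist y p ≤ 2} : ℝ) * (1 + α) ≤ (b ^ 2 + b + 1) * (1 + α * (b + 1)) :=
      le_of_mul_le_mul_right (by linarith) (by positivity : (0 : ℝ) < b + 1)
    have h2 : (0 : ℝ) < (b ^ 2 + b + 1) * b := by positivity
    linarith
  exact_mod_cast lt_of_mul_lt_mul_right hlt hpos.le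

/-- Exactly `b + 1` lines through a point are close to a point at distance two. -/
lemma card_closeLines_eq (h : HasClassicalParams G D b α β cc aa bb) (hb : 2 ≤ b) (hD : 3 ≤ D)
    {L : Finset (Finset V)} (hL : IsLineSystem G L) {s K : ℕ} (hs2 : b + 2 ≤ s)
    (hs : ∀ x, #(linesAt L x) ≤ s)
    (hfar : ∀ ℓ ∈ L, ∀ z ∈ ℓ, ∀ y, G.dist y z = 3 → #{p ∈ ℓ | G.dist y p ≤ 2} ≤ K + 1)
    (hw : ∀ ℓ ∈ L, β + α * (gauss b D - 1) - b * (s - 1) + 1 ≤ #ℓ)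
    (h1 : ((b : ℝ) + 2) * (b + 1) * (s - 1) - (b * (b + 1) + gauss b D - 1) * α < β)
    (h2 : (K : ℝ) * (s - b) - α * (b + 1) * gauss b D + α * (b + 1) ^ 2 < β)
    (h3 : (K : ℝ) * (s - b) + b * (s - 1) < β + α * (gauss b D - 1)) {x y : V}
    (hxy : G.dist x y = 2) : #(closeLines G L x y) = b + 1 := by
  have hyx : G.dist y x = 2 := G.dist_comm.trans hxy
  have hbR : (2 : ℝ) ≤ b := by exact_mod_cast hb
  have hsR : (b : ℝ) + 2 ≤ s := by exact_mod_cast hs2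
  rcases lt_trichotomy #(closeLines G L x y) (b + 1) with hlt | heq | hgt
  · exfalso
    have hβ : 0 < β := by simpa [gauss_zero] using h.sub_pos (by omega) (i := 0) (by omega)
    have hαβ := h.sub_pos (by omega) (i := 2) hD
    rw [gauss_two] at hαβ
    have hsum := congrArg (Nat.cast (R := ℝ)) (hL.sum_closeLines h.1 (by omega) hyx)
    rw [Nat.cast_add, Nat.cast_add, h.c_two_add_a_two (by omega), Nat.cast_sum,
      Nat.cast_sum] at hsum
    have hA : ∑ ℓ ∈ closeLines G L x y, ((#ℓ - 1 : ℕ) : ℝ) ≤ #(closeLines G L x y) • β := by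
      refine sum_le_card_nsmul _ _ _ fun ℓ hℓ => ?_
      have hℓL := (mem_closeLines.mp hℓ).1.1
      have := h.card_clique_le (by omega) (by omega) (hL.adj ℓ hℓL)
      have := hL.two_le_card ℓ hℓL
      push_cast [Nat.cast_sub (by omega : 1 ≤ #ℓ)]
      linarith
    have hB : ∑ ℓ ∈ linesAt L x \ closeLines G L x y,
        ((#{p ∈ ℓ.erase x | G.dist y p ≤ 2} : ℕ) : ℝ) ≤
          #(linesAt L x \ closeLines G L x y) • (K : ℝ) := by
      refine sum_le_card_nsmul _ _ _ fun ℓ hℓ => ?_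
      rw [mem_sdiff, mem_closeLines, mem_linesAt] at hℓ
      obtain ⟨⟨hℓL, hxℓ⟩, hnot⟩ := hℓ
      have hz : ∃ z ∈ ℓ, 2 < G.dist y z := by
        by_contra! hall
        exact hnot ⟨⟨hℓL, hxℓ⟩, hall⟩
      obtain ⟨z, hz, hyz⟩ := hz
      have h4 := h.1.1.dist_triangle (u := y) (v := x) (w := z)
      have h5 := hL.dist_le_one hℓL hxℓ hz
      have h6 := hfar ℓ hℓL z hz y (by omega)
      have h7 : #{p ∈ ℓ.erase x | G.dist y p ≤ 2} < #{p ∈ ℓ | G.dist y p ≤ 2} := by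
        refine card_lt_card (ssubset_iff_of_subset ?_ |>.mpr ⟨x, ?_, ?_⟩)
        · exact filter_subset_filter _ (erase_subset x ℓ)
        · exact mem_filter.mpr ⟨hxℓ, hyx.le⟩
        · simp
      exact_mod_cast (by omega : #{p ∈ ℓ.erase x | G.dist y p ≤ 2} ≤ K)
    rw [card_sdiff_of_subset closeLines_subset, nsmul_eq_mul,
      Nat.cast_sub (card_le_card closeLines_subset)] at hB
    rw [nsmul_eq_mul] at hA
    have hsx : (#(linesAt L x) : ℝ) ≤ s := by exact_mod_cast hs x
    have hg : (#(closeLines G L x y) : ℝ) ≤ b := by exact_mod_cast (by omega)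
    exact false_of_few_close_lines hbR (Nat.cast_nonneg K) hg (Nat.cast_nonneg _) hsx hsR
      (by linarith) h2 h3 (by linarith)
  · exact heq
  · exfalso
    have hsum := h.card_closeLines_mul_le (by omega) hL hw hyx
    have hg : (b : ℝ) + 2 ≤ #(closeLines G L x y) := by exact_mod_cast (by omega)
    have hw0 : 0 ≤ β + α * (gauss b D - 1) - b * (s - 1) := by
      have : (0 : ℝ) ≤ K * (s - b) := mul_nonneg (Nat.cast_nonneg K) (by linarith)
      linarith
    have := (mul_le_mul_of_nonneg_right hg hw0).trans hsum
    have : (0 : ℝ) < (b + 2) * (s - 1) := mul_pos (by linarith) (by linarith)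
    linarith

end HasClassicalParams

end MainArgument

/-- sufficient conditions on `β` for a distance-regular graph with classical
parameters `(D, b, α, β)`, `b ≥ 2`, `D ≥ 3`, having the SPLS(s) property, to be geometric. -/
theorem statement_9 {V : Type*} [Fintype V] (G : SimpleGraph V) (D b : ℕ) (α β : ℝ)
    (cc aa bb : ℕ → ℕ) (hb : 2 ≤ b) (hD : 3 ≤ D)
    (h : HasClassicalParams G D b α β cc aa bb)
    (s : ℕ) (hs : 1 ≤ s) (hspls : HasSPLS G (aa 1) (cc 2) s)
    (h1 : ((b : ℝ) + 2) * ((b : ℝ) + 1) * ((s : ℝ) - 1)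
        - ((b : ℝ) * ((b : ℝ) + 1) + gauss b D - 1) * α < β)
    (h2 : (((b : ℝ) + 1) * ((b : ℝ) ^ 2 + (b : ℝ) + 1) - 2) * ((s : ℝ) - (b : ℝ))
        - α * ((b : ℝ) + 1) * gauss b D + α * ((b : ℝ) + 1) ^ 2 < β)
    (h3 : (((b : ℝ) + 1) * ((b : ℝ) ^ 2 + (b : ℝ) + 1) - 2 + (b : ℝ)) * ((s : ℝ) - (b : ℝ))
        - α * (gauss b D - 1) + (b : ℝ) ^ 2 - (b : ℝ) < β) :
    IsGeometric G (β + 1) := by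
  classical
  obtain ⟨L, hL, hdeg, hnbr, hmem⟩ := hspls.exists_lineSystem
  obtain ⟨-, hs2, ha, hpoint, -, -⟩ := hspls
  have hne : Nonempty V := h.1.1.nonempty
  have hbR : (2 : ℝ) ≤ b := by exact_mod_cast hb
  have hr := gauss_le (b := b) (by omega) hD
  rw [gauss_three] at hr
  have hge : ∀ x, b ^ 2 + b + 1 ≤ (linesAt L x).card := fun x => by
    exact_mod_cast hr.trans (h.card_linesAt_ge (by omega) (by omega) hL x)
  have hsge : b ^ 2 + b + 1 ≤ s := (hge hne.some).trans (hdeg hne.some)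
  have hbb : 2 * b ≤ b ^ 2 := by nlinarith
  have hadj := h.card_adj_line_le hb hD hL hs2 hdeg hnbr (by exact_mod_cast ha) h1
  obtain ⟨K, hK⟩ : ∃ K, K + 2 = (b + 1) * (b ^ 2 + b + 1) :=
    ⟨(b + 1) * (b ^ 2 + b + 1) - 2, Nat.sub_add_cancel (by nlinarith)⟩
  have hKR : ((b : ℝ) + 1) * (b ^ 2 + b + 1) - 2 = K := by
    have : (K : ℝ) + 2 = (b + 1) * (b ^ 2 + b + 1) := by exact_mod_cast hK
    linarith
  rw [hKR] at h2 h3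
  have hfar : ∀ ℓ ∈ L, ∀ z ∈ ℓ, ∀ y, G.dist y z = 3 →
      (ℓ.filter fun p => G.dist y p ≤ 2).card ≤ K + 1 := by
    intro ℓ hℓ z hz y hyz
    have := h.card_close_le (by omega) hD hL hadj hℓ hz hyz
    omega
  have hline : ∀ ℓ ∈ L, β + α * (gauss b D - 1) - b * (s - 1) + 1 ≤ ℓ.card := by
    intro ℓ hℓ
    have hle : ((aa 1 + 2 : ℕ) : ℝ) ≤ ((ℓ.card + b * (s - 1) : ℕ) : ℝ) := by
      exact_mod_cast hL.le_card_line h.1 (by omega) hadj hdeg hℓ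
    push_cast [Nat.cast_sub hs] at hle
    have := h.a_one_add_one (by omega)
    linarith
  have h3' : (K : ℝ) * (s - b) + b * (s - 1) < β + α * (gauss b D - 1) := by linarith
  obtain ⟨q, rfl⟩ : ∃ q, s = b + q := ⟨s - b, by omega⟩
  have hsize : ∀ ℓ ∈ L, K * q + 1 < ℓ.card := by
    intro ℓ hℓ
    have := hline ℓ hℓ
    push_cast at this h3'
    have : (K : ℝ) * q + 1 < ℓ.card := by linarith
    exact_mod_cast this
  have hclose : ∀ x y, G.dist x y = 2 → (closeLines G L x y).card = b + 1 := fun x y hxy =>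
    h.card_closeLines_eq hb hD hL (by omega) hdeg hfar hline h1 h2 h3' hxy
  have hconst : ∀ x y, (linesAt L x).card = (linesAt L y).card := by
    intro x y
    obtain ⟨w⟩ := h.1.1.preconnected x y
    induction w with
    | nil => rfl
    | cons hxz _ ih =>
      exact (hL.card_linesAt_eq_of_adj h.1.1 (by omega) (fun x => by have := hge x; omega) hdeg
        hclose hfar hsize hxz).trans ih
  have hsize' : ∀ ℓ ∈ L, (linesAt L hne.some).card < ℓ.card := by
    intro ℓ hℓ
    have hK2 : 2 ≤ K := by nlinarith
    have := hsize ℓ hℓ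
    have := hdeg hne.some
    have := Nat.mul_le_mul_right q hK2
    omega
  obtain ⟨f, hf0, hf⟩ := hL.exists_eigenvector (fun x => hconst x hne.some) hsize'
  have hle := h.le_gauss_of_eigenvector (by omega) (by omega) hf0 hf
  have hcard : ∀ ℓ ∈ L, (ℓ.card : ℝ) = β + 1 := fun ℓ hℓ =>
    h.card_line_eq (by omega) (by omega) hL (fun x => by rw [hconst x hne.some]; exact hle) hℓ
  refine ⟨splsLines G (aa 1) (cc 2) (b + q), fun C hC => ⟨hC.1.1, ?_⟩, hpoint⟩
  rw [Set.ncard_eq_toFinset_card']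
  exact hcard _ ((hmem _).mpr (by simpa using hC))
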